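/- (Solutions of the Euler–Lagrange–Hamilton equations cover solutions of the higher-order Euler–Lagrange equations.) Suppose C^∞ fields u^α_I : ℝⁿ → ℝ (α ≤ m, |I| ≤ k) and p_α^{I,i} : ℝⁿ → ℝ (α ≤ m, |I| ≤ k−1, 1 ≤ i ≤ n) satisfy the Euler–Lagrange–Hamilton system of L: (i) ∂_i u^α_I = u^α_{I+e_i} for |I| ≤ k−1 and all i; (ii) Σ_i ∂_i p_α^{I,i}(x) = (∂L/∂u^α_I)(x, u(x)) − Σ_{j : I_j ≥ 1} p_α^{I−e_j, j}(x) for |I| ≤ k−1; (iii) Σ_{j : I_j ≥ 1} p_α^{I−e_j, j}(x) = (∂L/∂u^α_I)(x, u(x)) for |I| = k. Then the fields s^α := u^α_0 satisfy u^α_I = ∂^I s^α for all |I| ≤ k, and s = (s^α) satisfies the k-th order Euler–Lagrange equations of L: for every α and every x ∈ ℝⁿ, Σ_{|I| ≤ k} (−1)^{|I|} ∂^I [ x ↦ (∂L/∂u^α_I)(x, (∂^J s^β(x))_{β,|J|≤k}) ](x) = 0. -/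

import Mathlib

/-- Multi-indices of order ≤ k (jet coordinates of order ≤ k). -/
abbrev Adx (n k : ℕ) := {I : Fin n → ℕ // (∑ j, I j) ≤ k}

/-- Multi-indices of order ≤ k−1. -/
abbrev Bdx (n k : ℕ) := {I : Fin n → ℕ // (∑ j, I j) + 1 ≤ k}

noncomputable instance {n k : ℕ} : Fintype (Adx n k) :=
  Fintype.ofInjective
    (fun I : Adx n k => (fun j => (⟨I.1 j, by
        have h1 : I.1 j ≤ ∑ l, I.1 l :=
          Finset.single_le_sum (fun a _ => Nat.zero_le _) (Finset.mem_univ j)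
        have h2 := I.2
        omega⟩ : Fin (k + 1))))
    (fun I J h => Subtype.ext (funext fun j => congrArg Fin.val (congrFun h j)))

noncomputable instance {n k : ℕ} : Fintype (Bdx n k) :=
  Fintype.ofInjective
    (fun I : Bdx n k => (fun j => (⟨I.1 j, by
        have h1 : I.1 j ≤ ∑ l, I.1 l :=
          Finset.single_le_sum (fun a _ => Nat.zero_le _) (Finset.mem_univ j)
        have h2 := I.2
        omega⟩ : Fin (k + 1))))
    (fun I J h => Subtype.ext (funext fun j => congrArg Fin.val (congrFun h j)))

/-- Inclusion of multi-indices of order ≤ k−1 into those of order ≤ k. -/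
def inclA {n k : ℕ} (I : Bdx n k) : Adx n k := ⟨I.1, Nat.le_of_succ_le I.2⟩

/-- The multi-index I + e_i, for |I| ≤ k−1 (so that |I + e_i| ≤ k). -/
def succA {n k : ℕ} (I : Bdx n k) (i : Fin n) : Adx n k :=
  ⟨fun l => I.1 l + (Pi.single i 1 : Fin n → ℕ) l, by
    show (∑ l, (I.1 l + (Pi.single i 1 : Fin n → ℕ) l)) ≤ k
    have h1 : (∑ l, (I.1 l + (Pi.single i 1 : Fin n → ℕ) l)) = (∑ l, I.1 l) + 1 := by
      simp [Finset.sum_add_distrib, Finset.sum_pi_single']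
    have h2 := I.2
    omega⟩

/-- The multi-index I − e_j, defined for |I| ≤ k with I_j ≥ 1 (so |I − e_j| ≤ k−1). -/
def predB {n k : ℕ} (I : Adx n k) (j : Fin n) (h : 1 ≤ I.1 j) : Bdx n k :=
  ⟨fun l => I.1 l - (Pi.single j 1 : Fin n → ℕ) l, by
    show (∑ l, (I.1 l - (Pi.single j 1 : Fin n → ℕ) l)) + 1 ≤ k
    have hle : ∀ l, (Pi.single j 1 : Fin n → ℕ) l ≤ I.1 l := by
      intro l
      by_cases hl : l = j
      · subst hl; simpa using h
      · simp [Pi.single_eq_of_ne hl]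
    have h1 : (∑ l, (I.1 l - (Pi.single j 1 : Fin n → ℕ) l))
        + (∑ l, (Pi.single j 1 : Fin n → ℕ) l) = ∑ l, I.1 l := by
      rw [← Finset.sum_add_distrib]
      exact Finset.sum_congr rfl fun l _ => Nat.sub_add_cancel (hle l)
    have h2 : (∑ l, (Pi.single j 1 : Fin n → ℕ) l) = 1 := by
      simp [Finset.sum_pi_single']
    have h3 := I.2
    omega⟩

/-- The partial derivative ∂_i of a function `f : ℝⁿ → ℝ`. -/
noncomputable def pd {n : ℕ} (i : Fin n) (f : (Fin n → ℝ) → ℝ) : (Fin n → ℝ) → ℝ :=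
  fun x => fderiv ℝ f x (Pi.single i 1)

/-- The Euler–Lagrange expression `EL_a[ℒ; q](x)` of a first-order Lagrangian
`ℒ(x, q, v)` (fields indexed by a finite set `S`), evaluated on fields `q`:
`(∂ℒ/∂q_a)(x, q(x), Dq(x)) − Σ_i ∂_i [(∂ℒ/∂v_{a,i})(·, q(·), Dq(·))](x)`. -/
noncomputable def EL {n : ℕ} {S : Type} [DecidableEq S] [Fintype S]
    (ℒ : (Fin n → ℝ) → (S → ℝ) → (S → Fin n → ℝ) → ℝ)
    (q : S → (Fin n → ℝ) → ℝ) (a : S) (x : Fin n → ℝ) : ℝ :=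
  fderiv ℝ (fun w : S → ℝ => ℒ x w (fun b i => pd i (q b) x)) (fun b => q b x) (Pi.single a 1)
    - ∑ i, pd i (fun y =>
        fderiv ℝ (fun v : S → Fin n → ℝ => ℒ y (fun b => q b y) v)
          (fun b j => pd j (q b) y) (Pi.single a (Pi.single i 1))) x

/-- Index set for the fields of the extended first-order theory:
the fields u^α_I (|I| ≤ k) and the multi-momenta p_α^{I,i} (|I| ≤ k−1). -/
abbrev Sidx (n m k : ℕ) := (Fin m × Adx n k) ⊕ (Fin m × Bdx n k × Fin n)

/-- The extended first-order Lagrangian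
`L₁ = L(x,u) + Σ_{α,|I|≤k−1,i} p_α^{I,i} (u̇^α_{I,i} − u^α_{I+e_i})`. -/
noncomputable def LExt {n m k : ℕ} (L : (Fin n → ℝ) → (Fin m → Adx n k → ℝ) → ℝ) :
    (Fin n → ℝ) → (Sidx n m k → ℝ) → (Sidx n m k → Fin n → ℝ) → ℝ :=
  fun x q v =>
    L x (fun α I => q (Sum.inl (α, I))) +
      ∑ α : Fin m, ∑ I : Bdx n k, ∑ i : Fin n,
        q (Sum.inr (α, I, i)) * (v (Sum.inl (α, inclA I)) i - q (Sum.inl (α, succA I i)))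

/-- The joint field `(u, p)` of the extended first-order theory. -/
def jointFields {n m k : ℕ} (u : Fin m → Adx n k → (Fin n → ℝ) → ℝ)
    (p : Fin m → Bdx n k → Fin n → (Fin n → ℝ) → ℝ) : Sidx n m k → (Fin n → ℝ) → ℝ :=
  fun a => match a with
    | Sum.inl (α, I) => u α I
    | Sum.inr (α, I, i) => p α I i

/-- The partial derivative ∂L/∂u^α_I of a k-th order Lagrangian density
coefficient `L(x, u)`, evaluated at `(x, w)`. -/
noncomputable def dLdu {n m k : ℕ} (L : (Fin n → ℝ) → (Fin m → Adx n k → ℝ) → ℝ)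
    (α : Fin m) (I : Adx n k) (x : Fin n → ℝ) (w : Fin m → Adx n k → ℝ) : ℝ :=
  fderiv ℝ (L x) w (Pi.single α (Pi.single I 1))

/-- The iterated partial derivative ∂^I = ∂₁^{I₁} ⋯ ∂ₙ^{Iₙ} of `f : ℝⁿ → ℝ`,
for a multi-index `I : ℕⁿ`. -/
noncomputable def pdM {n : ℕ} (I : Fin n → ℕ) (f : (Fin n → ℝ) → ℝ) : (Fin n → ℝ) → ℝ :=
  (List.finRange n).foldr (fun i g => (pd i)^[I i] g) f

/-- The zero multi-index. -/
def zeroA (n k : ℕ) : Adx n k := ⟨fun _ => 0, by simp⟩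

section helpers

abbrev Sm {n : ℕ} (f : (Fin n → ℝ) → ℝ) : Prop := ContDiff ℝ (⊤ : ℕ∞) f

theorem Sm.pd {n : ℕ} {f : (Fin n → ℝ) → ℝ} (hf : Sm f) (i : Fin n) : Sm (pd i f) := by
  have h : ContDiff ℝ (⊤ : ℕ∞) (fderiv ℝ f) := hf.fderiv_right (by simp)
  exact h.clm_apply contDiff_const

theorem Sm.diff {n : ℕ} {f : (Fin n → ℝ) → ℝ} (hf : Sm f) : Differentiable ℝ f :=
  hf.differentiable (by simp)

theorem pd_comm {n : ℕ} {f : (Fin n → ℝ) → ℝ} (hf : Sm f) (i j : Fin n) :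
    pd i (pd j f) = pd j (pd i f) := by
  have h : ContDiff ℝ (⊤ : ℕ∞) (fderiv ℝ f) := hf.fderiv_right (by simp)
  have hd : Differentiable ℝ (fderiv ℝ f) := h.differentiable (by simp)
  funext x
  have key : ∀ a b : Fin n, pd a (pd b f) x
      = fderiv ℝ (fderiv ℝ f) x (Pi.single a 1) (Pi.single b 1) := by
    intro a b
    unfold pd
    rw [fderiv_clm_apply (hd x) (differentiableAt_const _)]
    simp
  rw [key, key]
  have hs : IsSymmSndFDerivAt ℝ f x :=
    (hf.contDiffAt).isSymmSndFDerivAt (by rw [minSmoothness_of_isRCLikeNormedField]; exact WithTop.coe_le_coe.mpr (le_top : (2 : ℕ∞) ≤ ⊤))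
  exact hs _ _

theorem pd_add {n : ℕ} {f g : (Fin n → ℝ) → ℝ} (hf : Sm f) (hg : Sm g) (i : Fin n) :
    pd i (fun y => f y + g y) = fun y => pd i f y + pd i g y := by
  funext x
  unfold pd
  rw [fderiv_fun_add (hf.diff x) (hg.diff x)]
  rfl

theorem Sm.iter {n : ℕ} {f : (Fin n → ℝ) → ℝ} (hf : Sm f) (i : Fin n) (a : ℕ) :
    Sm ((_root_.pd i)^[a] f) := by
  induction a with
  | zero => exact hf
  | succ a ih => rw [Function.iterate_succ_apply']; exact ih.pd i

theorem iter_comm {n : ℕ} {f : (Fin n → ℝ) → ℝ} (hf : Sm f) (i j : Fin n) (a : ℕ) :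
    (pd j)^[a] (pd i f) = pd i ((pd j)^[a] f) := by
  induction a with
  | zero => rfl
  | succ a ih =>
    rw [Function.iterate_succ_apply', Function.iterate_succ_apply', ih, pd_comm (hf.iter j a)]

theorem iter_add {n : ℕ} {f g : (Fin n → ℝ) → ℝ} (hf : Sm f) (hg : Sm g) (i : Fin n) (a : ℕ) :
    (pd i)^[a] (fun y => f y + g y) = fun y => (pd i)^[a] f y + (pd i)^[a] g y := by
  induction a with
  | zero => rfl
  | succ a ih =>
    rw [Function.iterate_succ_apply', Function.iterate_succ_apply', Function.iterate_succ_apply',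
      ih, pd_add (hf.iter i a) (hg.iter i a)]

theorem pd_zero' {n : ℕ} (i : Fin n) : pd i (fun _ => (0:ℝ)) = fun _ => 0 := by
  funext x; simp [pd]

/-- Iterated derivative along a list. -/
noncomputable def pdL {n : ℕ} (l : List (Fin n)) (I : Fin n → ℕ) (f : (Fin n → ℝ) → ℝ) :
    (Fin n → ℝ) → ℝ := l.foldr (fun i g => (pd i)^[I i] g) f

theorem pdL_cons {n : ℕ} (a : Fin n) (l : List (Fin n)) (I : Fin n → ℕ)
    (f : (Fin n → ℝ) → ℝ) : pdL (a :: l) I f = (pd a)^[I a] (pdL l I f) := rfl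

theorem Sm.pdL {n : ℕ} {f : (Fin n → ℝ) → ℝ} (hf : Sm f) (l : List (Fin n)) (I : Fin n → ℕ) :
    Sm (pdL l I f) := by
  induction l with
  | nil => exact hf
  | cons a l ih => rw [pdL_cons]; exact ih.iter a _

theorem pdL_add {n : ℕ} {f g : (Fin n → ℝ) → ℝ} (hf : Sm f) (hg : Sm g) (l : List (Fin n))
    (I : Fin n → ℕ) : pdL l I (fun y => f y + g y) = fun y => pdL l I f y + pdL l I g y := by
  induction l with
  | nil => rfl
  | cons a l ih => rw [pdL_cons, pdL_cons, pdL_cons, ih, iter_add (hf.pdL l I) (hg.pdL l I)]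

theorem pdL_zero {n : ℕ} (l : List (Fin n))
    (I : Fin n → ℕ) : pdL l I (fun _ => (0:ℝ)) = fun _ => 0 := by
  induction l with
  | nil => rfl
  | cons a l ih =>
    rw [pdL_cons, ih]
    exact Function.iterate_fixed (pd_zero' a) _

theorem pdL_pd {n : ℕ} {f : (Fin n → ℝ) → ℝ} (hf : Sm f) (l : List (Fin n)) (I : Fin n → ℕ)
    (i : Fin n) : pdL l I (pd i f) = pd i (pdL l I f) := by
  induction l with
  | nil => rfl
  | cons a l ih => rw [pdL_cons, pdL_cons, ih, iter_comm (hf.pdL l I)]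

theorem pdL_succ_notMem {n : ℕ} {f : (Fin n → ℝ) → ℝ} (l : List (Fin n))
    (I : Fin n → ℕ) (i : Fin n) (hi : i ∉ l) :
    pdL l (fun t => I t + (Pi.single i 1 : Fin n → ℕ) t) f = pdL l I f := by
  induction l with
  | nil => rfl
  | cons a l ih =>
    simp only [List.mem_cons, not_or] at hi
    rw [pdL_cons, pdL_cons, ih hi.2, Pi.single_eq_of_ne (Ne.symm hi.1)]
    rfl

theorem pdL_succ {n : ℕ} {f : (Fin n → ℝ) → ℝ} (hf : Sm f) (l : List (Fin n))
    (I : Fin n → ℕ) (i : Fin n) (hl : l.Nodup) (hi : i ∈ l) :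
    pdL l (fun t => I t + (Pi.single i 1 : Fin n → ℕ) t) f = pd i (pdL l I f) := by
  induction l with
  | nil => simp at hi
  | cons a l ih =>
    rw [List.nodup_cons] at hl
    rw [pdL_cons, pdL_cons]
    by_cases h : i = a
    · subst h
      rw [pdL_succ_notMem l I i hl.1, Pi.single_eq_same, Function.iterate_succ_apply']
    · have hi' : i ∈ l := by simpa [h] using hi
      rw [ih hl.2 hi', Pi.single_eq_of_ne (Ne.symm h), Nat.add_zero, iter_comm (hf.pdL l I)]

theorem pdM_succ {n : ℕ} {f : (Fin n → ℝ) → ℝ} (hf : Sm f) (I : Fin n → ℕ) (i : Fin n) :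
    pdM (fun t => I t + (Pi.single i 1 : Fin n → ℕ) t) f = pd i (pdM I f) :=
  pdL_succ hf _ I i (List.nodup_finRange n) (List.mem_finRange i)

theorem pdM_pd {n : ℕ} {f : (Fin n → ℝ) → ℝ} (hf : Sm f) (I : Fin n → ℕ) (i : Fin n) :
    pdM I (pd i f) = pd i (pdM I f) := pdL_pd hf _ I i

theorem pdM_add {n : ℕ} {f g : (Fin n → ℝ) → ℝ} (hf : Sm f) (hg : Sm g) (I : Fin n → ℕ) :
    pdM I (fun y => f y + g y) = fun y => pdM I f y + pdM I g y := pdL_add hf hg _ I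

theorem pdM_zero {n : ℕ} (I : Fin n → ℕ) : pdM I (fun _ => (0:ℝ)) = fun _ => 0 := pdL_zero _ I

theorem pdM_sum {n : ℕ} {ι : Type*} (s : Finset ι) (F : ι → (Fin n → ℝ) → ℝ)
    (hF : ∀ i, Sm (F i)) (I : Fin n → ℕ) :
    pdM I (fun y => ∑ i ∈ s, F i y) = fun y => ∑ i ∈ s, pdM I (F i) y := by
  classical
  induction s using Finset.induction_on with
  | empty => simpa using pdM_zero I
  | insert a s ha ih =>
    simp only [Finset.sum_insert ha]
    have h : Sm (fun y => ∑ i ∈ s, F i y) := ContDiff.sum fun i _ => hF i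
    rw [pdM_add (hF a) h, ih]

theorem pdM_idx_zero {n : ℕ} (f : (Fin n → ℝ) → ℝ) : pdM (fun _ => 0) f = f := by
  unfold pdM
  induction (List.finRange n) with
  | nil => rfl
  | cons a l ih => rw [List.foldr_cons, ih]; rfl

theorem succA_predB {n k : ℕ} (I : Adx n k) (j : Fin n) (h : 1 ≤ I.1 j) :
    succA (predB I j h) j = I := by
  apply Subtype.ext
  funext l
  show I.1 l - (Pi.single j 1 : Fin n → ℕ) l + (Pi.single j 1 : Fin n → ℕ) l = I.1 l
  by_cases hl : l = j
  · subst hl; rw [Pi.single_eq_same]; omega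
  · simp [Pi.single_eq_of_ne hl]

theorem succA_pos {n k : ℕ} (I : Bdx n k) (j : Fin n) : 1 ≤ (succA I j).1 j := by
  show 1 ≤ I.1 j + (Pi.single j 1 : Fin n → ℕ) j
  simp

theorem predB_succA {n k : ℕ} (I : Bdx n k) (j : Fin n) (h : 1 ≤ (succA I j).1 j) :
    predB (succA I j) j h = I := by
  apply Subtype.ext
  funext l
  show I.1 l + (Pi.single j 1 : Fin n → ℕ) l - (Pi.single j 1 : Fin n → ℕ) l = I.1 l
  omega

theorem deg_succA {n k : ℕ} (I : Bdx n k) (j : Fin n) :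
    (∑ l, (succA I j).1 l) = (∑ l, I.1 l) + 1 := by
  show (∑ l, (I.1 l + (Pi.single j 1 : Fin n → ℕ) l)) = _
  simp [Finset.sum_add_distrib, Finset.sum_pi_single']

theorem sum_pred {n k : ℕ} (j : Fin n) (g : Adx n k → Bdx n k → ℝ) :
    (∑ I : Adx n k, if h : 1 ≤ I.1 j then g I (predB I j h) else 0)
      = ∑ I : Bdx n k, g (succA I j) I := by
  symm
  apply Finset.sum_of_injOn (fun I => succA I j)
  · intro I _ J _ h
    have h' : succA I j = succA J j := h
    apply Subtype.ext
    funext l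
    have := congrFun (congrArg Subtype.val h') l
    change I.1 l + (Pi.single j 1 : Fin n → ℕ) l = J.1 l + (Pi.single j 1 : Fin n → ℕ) l at this
    omega
  · intro I _; simp
  · intro I _ hI
    rw [dif_neg]
    intro h
    exact hI ⟨predB I j h, by simp, succA_predB I j h⟩
  · intro I _
    rw [dif_pos (succA_pos I j), predB_succA]

theorem sum_incl {n k : ℕ} (g : Adx n k → Bdx n k → ℝ) :
    (∑ I : Adx n k, if h : (∑ l, I.1 l) + 1 ≤ k then g I ⟨I.1, h⟩ else 0)
      = ∑ I : Bdx n k, g (inclA I) I := by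
  symm
  apply Finset.sum_of_injOn (fun I => inclA I)
  · intro I _ J _ h
    have h' : inclA I = inclA J := h
    exact Subtype.ext (congrArg Subtype.val h' :)
  · intro I _; simp
  · intro I _ hI
    rw [dif_neg]
    intro h
    exact hI ⟨⟨I.1, h⟩, by simp, rfl⟩
  · intro I _
    rw [dif_pos (show (∑ l, (inclA I).1 l) + 1 ≤ k from I.2)]
    rfl

end helpers

/-!
STATEMENT 7: solutions of the Euler–Lagrange–Hamilton system of L cover
solutions of the k-th order Euler–Lagrange equations of L: if (u, p) satisfies
(i)–(iii), then u is the k-jet prolongation of s := u_0 and s satisfies the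
k-th order Euler–Lagrange equations of L.
-/

theorem EulerLagrangeHamilton_covers_higher_EulerLagrange
    (n m k : ℕ) (hn : 1 ≤ n) (hm : 1 ≤ m) (hk : 2 ≤ k)
    (L : (Fin n → ℝ) → (Fin m → Adx n k → ℝ) → ℝ)
    (hL : ContDiff ℝ (⊤ : ℕ∞)
      (fun z : (Fin n → ℝ) × (Fin m → Adx n k → ℝ) => L z.1 z.2))
    (u : Fin m → Adx n k → (Fin n → ℝ) → ℝ)
    (hu : ∀ α I, ContDiff ℝ (⊤ : ℕ∞) (u α I))
    (p : Fin m → Bdx n k → Fin n → (Fin n → ℝ) → ℝ)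
    (hp : ∀ α I i, ContDiff ℝ (⊤ : ℕ∞) (p α I i))
    -- (i) the holonomy equations ∂_i u^α_I = u^α_{I+e_i}, |I| ≤ k−1
    (heq1 : ∀ (α : Fin m) (I : Bdx n k) (i : Fin n) (x : Fin n → ℝ),
        pd i (u α (inclA I)) x = u α (succA I i) x)
    -- (ii) Σ_i ∂_i p_α^{I,i} = ∂L/∂u^α_I − Σ_{j : I_j ≥ 1} p_α^{I−e_j,j}, |I| ≤ k−1
    (heq2 : ∀ (α : Fin m) (I : Bdx n k) (x : Fin n → ℝ),
        ∑ i, pd i (p α I i) x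
          = dLdu L α (inclA I) x (fun β J => u β J x)
            - ∑ j, if h : 1 ≤ I.1 j then p α (predB (inclA I) j h) j x else 0)
    -- (iii) Σ_{j : I_j ≥ 1} p_α^{I−e_j,j} = ∂L/∂u^α_I, |I| = k
    (heq3 : ∀ (α : Fin m) (I : Adx n k), (∑ l, I.1 l) = k → ∀ x : Fin n → ℝ,
        (∑ j, if h : 1 ≤ I.1 j then p α (predB I j h) j x else 0)
          = dLdu L α I x (fun β J => u β J x)) :
    -- then u is the k-jet prolongation of s := u_0 ...
    (∀ (α : Fin m) (I : Adx n k) (x : Fin n → ℝ), u α I x = pdM I.1 (u α (zeroA n k)) x) ∧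
    -- ... and s satisfies the k-th order Euler–Lagrange equations of L:
    (∀ (α : Fin m) (x : Fin n → ℝ),
        ∑ I : Adx n k, (-1 : ℝ) ^ (∑ l, I.1 l) *
          pdM I.1
            (fun y => dLdu L α I y (fun β J => pdM J.1 (u β (zeroA n k)) y)) x = 0) := by
  have part1 : ∀ (d : ℕ) (α : Fin m) (I : Adx n k), (∑ l, I.1 l) = d →
      u α I = pdM I.1 (u α (zeroA n k)) := by
    intro d
    induction d with
    | zero =>
      intro α I hI
      have : I = zeroA n k := by
        apply Subtype.ext
        funext l
        exact (Finset.sum_eq_zero_iff.mp hI) l (Finset.mem_univ l)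
      subst this
      exact (pdM_idx_zero _).symm
    | succ d ih =>
      intro α I hI
      obtain ⟨j, hj⟩ : ∃ j, 1 ≤ I.1 j := by
        by_contra hcon
        push Not at hcon
        have : (∑ l, I.1 l) = 0 := Finset.sum_eq_zero fun l _ => by have := hcon l; omega
        omega
      obtain ⟨B, rfl⟩ : ∃ B : Bdx n k, I = succA B j := ⟨_, (succA_predB I j hj).symm⟩
      have hB : (∑ l, (inclA B).1 l) = d := by
        rw [deg_succA] at hI
        change (∑ l, B.1 l) = d
        omega
      have h1 : u α (succA B j) = pd j (u α (inclA B)) := funext fun x => (heq1 α B j x).symm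
      rw [h1, ih α _ hB]
      exact (pdM_succ (hu α _) B.1 j).symm
  have part1' : ∀ (α : Fin m) (I : Adx n k), pdM I.1 (u α (zeroA n k)) = u α I :=
    fun α I => (part1 _ α I rfl).symm
  refine ⟨fun α I x => congrFun (part1 _ α I rfl) x, ?_⟩
  intro α x
  simp only [part1']
  have hG : ∀ (I : Adx n k) (j : Fin n),
      Sm (fun y => if h : 1 ≤ I.1 j then p α (predB I j h) j y else 0) := by
    intro I j
    by_cases h : 1 ≤ I.1 j
    · simp only [dif_pos h]; exact hp _ _ _
    · simp only [dif_neg h]; exact contDiff_const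
  have hGs : ∀ I : Adx n k,
      Sm (fun y => ∑ j, if h : 1 ≤ I.1 j then p α (predB I j h) j y else 0) :=
    fun I => ContDiff.sum fun j _ => hG I j
  have hPG : ∀ I : Adx n k,
      pdM I.1 (fun y => ∑ j, if h : 1 ≤ I.1 j then p α (predB I j h) j y else 0) x
        = ∑ j, if h : 1 ≤ I.1 j then pdM I.1 (p α (predB I j h) j) x else 0 := by
    intro I
    rw [pdM_sum _ _ (hG I)]
    refine Finset.sum_congr rfl fun j _ => ?_
    by_cases h : 1 ≤ I.1 j
    · simp only [dif_pos h]
    · simp only [dif_neg h]; rw [pdM_zero]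
  have term : ∀ I : Adx n k,
      (-1 : ℝ) ^ (∑ l, I.1 l) * pdM I.1 (fun y => dLdu L α I y (fun β J => u β J y)) x
      = (if h : (∑ l, I.1 l) + 1 ≤ k then
          (-1 : ℝ) ^ (∑ l, I.1 l) * ∑ i, pd i (pdM I.1 (p α ⟨I.1, h⟩ i)) x else 0)
        + ∑ j, if h : 1 ≤ I.1 j then
          (-1 : ℝ) ^ (∑ l, I.1 l) * pdM I.1 (p α (predB I j h) j) x else 0 := by
    intro I
    have e2 : (∑ j, if h : 1 ≤ I.1 j then
          (-1 : ℝ) ^ (∑ l, I.1 l) * pdM I.1 (p α (predB I j h) j) x else 0)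
        = (-1 : ℝ) ^ (∑ l, I.1 l) *
          ∑ j, if h : 1 ≤ I.1 j then pdM I.1 (p α (predB I j h) j) x else 0 := by
      rw [Finset.mul_sum]
      refine Finset.sum_congr rfl fun j _ => ?_
      split_ifs <;> simp
    rw [e2, ← hPG]
    by_cases h : (∑ l, I.1 l) + 1 ≤ k
    · rw [dif_pos h, ← mul_add]
      congr 1
      have hfun : (fun y => dLdu L α I y (fun β J => u β J y))
          = fun y => (∑ i, pd i (p α ⟨I.1, h⟩ i) y)
            + ∑ j, if h : 1 ≤ I.1 j then p α (predB I j h) j y else 0 := by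
        funext y
        have := heq2 α ⟨I.1, h⟩ y
        rw [this]
        exact (sub_add_cancel _ _).symm
      have hS : Sm (fun y => ∑ i, pd i (p α ⟨I.1, h⟩ i) y) :=
        ContDiff.sum fun i _ => Sm.pd (hp α ⟨I.1, h⟩ i) i
      rw [hfun, pdM_add hS (hGs I), pdM_sum _ _ (fun i => Sm.pd (hp α ⟨I.1, h⟩ i) i)]
      simp only [pdM_pd (hp α ⟨I.1, h⟩ _)]
    · rw [dif_neg h, zero_add]
      have hk' : (∑ l, I.1 l) = k := by have := I.2; omega
      have hfun : (fun y => dLdu L α I y (fun β J => u β J y))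
          = fun y => ∑ j, if h : 1 ≤ I.1 j then p α (predB I j h) j y else 0 :=
        funext fun y => (heq3 α I hk' y).symm
      rw [hfun]
  rw [Finset.sum_congr rfl fun I _ => term I, Finset.sum_add_distrib,
    sum_incl (fun I B => (-1 : ℝ) ^ (∑ l, I.1 l) * ∑ i, pd i (pdM I.1 (p α B i)) x),
    Finset.sum_comm (s := (Finset.univ : Finset (Adx n k)))]
  rw [Finset.sum_congr rfl fun j _ =>
    sum_pred j (fun I B => (-1 : ℝ) ^ (∑ l, I.1 l) * pdM I.1 (p α B j) x)]
  rw [Finset.sum_comm (s := (Finset.univ : Finset (Fin n))), ← Finset.sum_add_distrib]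
  refine Finset.sum_eq_zero fun B _ => ?_
  rw [Finset.mul_sum, ← Finset.sum_add_distrib]
  refine Finset.sum_eq_zero fun i _ => ?_
  rw [deg_succA]
  have h1 : pdM (succA B i).1 (p α B i) = pd i (pdM B.1 (p α B i)) := pdM_succ (hp α B i) B.1 i
  rw [h1, pow_succ]
  simp only [inclA]
  ring
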